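/- arXiv:2007.08580 — 2 statements merged into one kernel-verified Lean document; each statement's English description precedes it below -/
import Mathlib

section
/- Bound on the remainder (non-Klein-Gordon) part of the resolvent kernel at low frequencies (Lemma 2.8): There exist δ' > 0, ν₀ > 0, λ₀ > 0 and C > 0 such that for every κ ∈ (0, ν₀): (i) 1 − 𝓛(−δ'·κ + i·ω, κ) ≠ 0 for every ω ∈ ℝ; (ii) the function ω ↦ 𝓛(−δ'·κ + i·ω, κ)/(1 − 𝓛(−δ'·κ + i·ω, κ)) is (absolutely) integrable on ℝ; and (iii) for every t ≥ 0, |(1/(2π))·∫_ℝ exp((−δ'·κ + i·ω)·t)·𝓛(−δ'·κ + i·ω,κ)/(1 − 𝓛(−δ'·κ + i·ω,κ)) dω| ≤ C·κ³·exp(−λ₀·κ·t). -/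
open MeasureTheory Complex

/-- The Fourier transform of the Maxwellian along a fixed direction:
`F(s) = n₀ · exp(−β s²/2)`. -/
noncomputable def Fmax (n₀ β : ℝ) (s : ℝ) : ℝ := n₀ * Real.exp (-β * s ^ 2 / 2)

/-- The plasma dispersion function
`𝓛(z,κ) = −(w₀/κ²) ∫₀^∞ s F(s) exp(−(z/κ) s) ds` with `w₀ = ωp²/n₀`. -/
noncomputable def disp (n₀ β ωp : ℝ) (z : ℂ) (κ : ℝ) : ℂ :=
  -(((ωp ^ 2 / n₀ : ℝ) : ℂ) / (κ : ℂ) ^ 2) *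
    ∫ s in Set.Ioi (0 : ℝ),
      ((s : ℝ) : ℂ) * ((Fmax n₀ β s : ℝ) : ℂ) * Complex.exp (-(z / (κ : ℂ)) * ((s : ℝ) : ℂ))


/-- Integrand of the moments of the Maxwellian. -/
noncomputable def momInt (β : ℝ) (k : ℕ) (ζ : ℂ) (s : ℝ) : ℂ :=
  (s : ℂ) ^ k * Complex.exp (-((β / 2 : ℝ) : ℂ) * (s : ℂ) ^ 2 - ζ * (s : ℂ))

/-- Laplace transform of the moments. -/
noncomputable def Hk (β : ℝ) (k : ℕ) (ζ : ℂ) : ℂ := ∫ s in Set.Ioi (0 : ℝ), momInt β k ζ s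

noncomputable def hBd (β : ℝ) (k : ℕ) (a : ℝ) (s : ℝ) : ℝ :=
  Real.exp (a ^ 2 / β) * (s ^ k * Real.exp (-(β / 4) * s ^ 2))

lemma hBd_integrable {β : ℝ} (hβ : 0 < β) (k : ℕ) (a : ℝ) :
    IntegrableOn (hBd β k a) (Set.Ioi 0) := by
  have h := integrable_rpow_mul_exp_neg_mul_sq (b := β / 4) (by positivity) (s := k)
    (by have : (0:ℝ) ≤ k := by positivity
        linarith)
  simp only [Real.rpow_natCast] at h
  exact (h.const_mul _).integrableOn

lemma momInt_norm_le {β : ℝ} (hβ : 0 < β) (k : ℕ) {a : ℝ} {ζ : ℂ} (ha : -ζ.re ≤ a) {s : ℝ}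
    (hs : 0 < s) : ‖momInt β k ζ s‖ ≤ hBd β k a s := by
  have hre : (-((β / 2 : ℝ) : ℂ) * (s : ℂ) ^ 2 - ζ * (s : ℂ)).re = -(β / 2) * s ^ 2 - ζ.re * s := by
    have : (-((β / 2 : ℝ) : ℂ) * (s : ℂ) ^ 2) = ((-(β / 2) * s ^ 2 : ℝ) : ℂ) := by push_cast; ring
    rw [this, sub_re, ofReal_re, re_mul_ofReal]
  rw [momInt, norm_mul, norm_pow, Complex.norm_exp, hre, Complex.norm_real, Real.norm_eq_abs,
    abs_of_pos hs, hBd, mul_left_comm, ← Real.exp_add]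
  gcongr
  have h1 : -ζ.re * s ≤ a * s := by gcongr
  have h2 : a * s ≤ a ^ 2 / β + β / 4 * s ^ 2 := by
    rw [← sub_nonneg]
    have : a ^ 2 / β + β / 4 * s ^ 2 - a * s = (a - β / 2 * s) ^ 2 / β := by
      field_simp; ring
    rw [this]; positivity
  linarith

lemma momInt_continuous (β : ℝ) (k : ℕ) (ζ : ℂ) : Continuous (momInt β k ζ) := by
  unfold momInt; fun_prop

lemma momInt_integrable {β : ℝ} (hβ : 0 < β) (k : ℕ) (ζ : ℂ) :
    IntegrableOn (momInt β k ζ) (Set.Ioi 0) := by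
  refine Integrable.mono' (hBd_integrable hβ k (-ζ.re))
    (momInt_continuous β k ζ).aestronglyMeasurable ?_
  filter_upwards [ae_restrict_mem measurableSet_Ioi] with s hs
  exact momInt_norm_le hβ k le_rfl hs

lemma Hk_norm_le {β : ℝ} (hβ : 0 < β) (k : ℕ) {a : ℝ} {ζ : ℂ} (ha : -ζ.re ≤ a) :
    ‖Hk β k ζ‖ ≤ ∫ s in Set.Ioi (0:ℝ), hBd β k a s := by
  refine norm_integral_le_of_norm_le (hBd_integrable hβ k a) ?_
  filter_upwards [ae_restrict_mem measurableSet_Ioi] with s hs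
  exact momInt_norm_le hβ k ha hs

lemma Hk_hasDerivAt {β : ℝ} (hβ : 0 < β) (k : ℕ) (ζ : ℂ) :
    HasDerivAt (Hk β k) (∫ s in Set.Ioi (0 : ℝ), -momInt β (k+1) ζ s) ζ := by
  refine (hasDerivAt_integral_of_dominated_loc_of_deriv_le (F := fun ζ s => momInt β k ζ s)
    (F' := fun ζ s => -momInt β (k+1) ζ s) (bound := hBd β (k+1) (-ζ.re + 1))
    (s := Metric.ball ζ 1) (Metric.ball_mem_nhds _ one_pos) ?_ (momInt_integrable hβ k ζ) ?_ ?_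
    (hBd_integrable hβ _ _) ?_).2
  · exact Filter.Eventually.of_forall fun z => (momInt_continuous β k z).aestronglyMeasurable
  · exact (momInt_continuous β _ ζ).neg.aestronglyMeasurable
  · filter_upwards [ae_restrict_mem measurableSet_Ioi] with s hs z hz
    rw [norm_neg]
    refine momInt_norm_le hβ _ ?_ hs
    have h1 : |(z - ζ).re| ≤ ‖z - ζ‖ := abs_re_le_norm _
    rw [Metric.mem_ball, dist_eq_norm] at hz
    have := (abs_le.1 h1).1
    simp at this
    linarith
  · filter_upwards with s z hz
    have h1 : HasDerivAt (fun z : ℂ => -((β / 2 : ℝ) : ℂ) * (s : ℂ) ^ 2 - z * (s : ℂ))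
        (-(s:ℂ)) z := by
      exact (((hasDerivAt_id z).mul_const (s:ℂ)).const_sub
        (-((β / 2 : ℝ) : ℂ) * (s : ℂ) ^ 2)).congr_deriv (by simp)
    have h2 := (h1.cexp).const_mul ((s:ℂ)^k)
    refine HasDerivAt.congr_deriv h2 ?_
    simp only [momInt]; ring

lemma Hk_differentiable {β : ℝ} (hβ : 0 < β) (k : ℕ) : Differentiable ℂ (Hk β k) :=
  fun ζ => (Hk_hasDerivAt hβ k ζ).differentiableAt

lemma momInt_hasDerivAt (β : ℝ) (k : ℕ) (ζ : ℂ) (s : ℝ) :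
    HasDerivAt (momInt β k ζ)
      ((k:ℂ) * momInt β (k-1) ζ s - β * momInt β (k+1) ζ s - ζ * momInt β k ζ s) s := by
  have h0 : HasDerivAt (fun s : ℝ => (s:ℂ)) 1 s := by
    simpa using (hasDerivAt_id s).ofReal_comp
  have h1 : HasDerivAt (fun s : ℝ => -((β / 2 : ℝ) : ℂ) * (s : ℂ) ^ 2 - ζ * (s : ℂ))
      (-((β / 2 : ℝ) : ℂ) * (2 * (s : ℂ)) - ζ) s := by
    exact (((h0.pow 2).const_mul (-((β / 2 : ℝ) : ℂ))).sub (h0.const_mul ζ)).congr_deriv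
      (by simp)
  have h2 := (h0.pow k).mul h1.cexp
  refine HasDerivAt.congr_deriv h2 ?_
  simp only [momInt, Pi.pow_apply]
  push_cast
  ring

lemma Hk_ibp {β : ℝ} (hβ : 0 < β) (k : ℕ) (ζ : ℂ) :
    (k:ℂ) * Hk β (k-1) ζ - β * Hk β (k+1) ζ - ζ * Hk β k ζ = - (0:ℂ)^k := by
  have hI : IntegrableOn (fun s => (k:ℂ) * momInt β (k-1) ζ s - β * momInt β (k+1) ζ s
      - ζ * momInt β k ζ s) (Set.Ioi 0) :=
    ((((momInt_integrable hβ (k-1) ζ).const_mul _).sub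
      ((momInt_integrable hβ (k+1) ζ).const_mul _)).sub ((momInt_integrable hβ k ζ).const_mul _))
  have h0 := tendsto_zero_of_hasDerivAt_of_integrableOn_Ioi
    (fun s _ => momInt_hasDerivAt β k ζ s) hI (momInt_integrable hβ k ζ)
  have := integral_Ioi_of_hasDerivAt_of_tendsto' (a := 0)
    (fun s _ => momInt_hasDerivAt β k ζ s) hI h0
  rw [integral_sub, integral_sub, integral_const_mul, integral_const_mul, integral_const_mul] at this
  · simpa [Hk, momInt] using this
  · exact (momInt_integrable hβ _ ζ).const_mul _
  · exact (momInt_integrable hβ _ ζ).const_mul _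
  · exact ((momInt_integrable hβ _ ζ).const_mul _).sub ((momInt_integrable hβ _ ζ).const_mul _)
  · exact (momInt_integrable hβ _ ζ).const_mul _

lemma Hk_key {β : ℝ} (hβ : 0 < β) (ζ : ℂ) :
    (ζ ^ 2 + 3 * β) * Hk β 1 ζ = 1 + β ^ 2 * Hk β 3 ζ := by
  have h0 := Hk_ibp hβ 0 ζ
  have h1 := Hk_ibp hβ 1 ζ
  have h2 := Hk_ibp hβ 2 ζ
  norm_num at h0 h1 h2
  linear_combination (-1) * h0 - ζ * h1 + β * h2

lemma Hk_decay {β : ℝ} (hβ : 0 < β) (a : ℝ) (m : ℕ) : ∀ k : ℕ, m ≤ k + 1 →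
    ∃ C : ℝ, ∀ ζ : ℂ, -ζ.re ≤ a → ‖ζ‖ ^ m * ‖Hk β k ζ‖ ≤ C := by
  induction m with
  | zero => intro k _; exact ⟨_, fun ζ h => by simpa using Hk_norm_le hβ k h⟩
  | succ m ih =>
    intro k hk
    rcases Nat.eq_zero_or_pos k with rfl | hk0
    · obtain rfl : m = 0 := by omega
      obtain ⟨C, hC⟩ := ih 1 (by omega)
      refine ⟨1 + β * C, fun ζ h => ?_⟩
      have h0 := Hk_ibp hβ 0 ζ
      have e : ζ * Hk β 0 ζ = 1 - β * Hk β 1 ζ := by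
        norm_num at h0; linear_combination (-1) * h0
      have := hC ζ h
      simp only [zero_add, pow_one]
      rw [← norm_mul, e]
      refine (norm_sub_le _ _).trans ?_
      simp [abs_of_pos hβ] at this ⊢
      gcongr
    · obtain ⟨C, hC⟩ := ih (k+1) (by omega)
      obtain ⟨C', hC'⟩ := ih (k-1) (by omega)
      refine ⟨k * C' + β * C, fun ζ h => ?_⟩
      have h0 := Hk_ibp hβ k ζ
      have e : ζ * Hk β k ζ = k * Hk β (k-1) ζ - β * Hk β (k+1) ζ := by
        rw [zero_pow hk0.ne'] at h0; linear_combination (-1) * h0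
      rw [pow_succ, mul_assoc, ← norm_mul, e]
      calc ‖ζ‖ ^ m * ‖(k:ℂ) * Hk β (k-1) ζ - β * Hk β (k+1) ζ‖
          ≤ ‖ζ‖ ^ m * (k * ‖Hk β (k-1) ζ‖ + β * ‖Hk β (k+1) ζ‖) := by
            gcongr
            refine (norm_sub_le _ _).trans ?_
            simp [abs_of_pos hβ]
        _ = k * (‖ζ‖ ^ m * ‖Hk β (k-1) ζ‖) + β * (‖ζ‖ ^ m * ‖Hk β (k+1) ζ‖) := by ring
        _ ≤ _ := by
            gcongr
            · exact hC' ζ h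
            · exact hC ζ h

lemma Hk_ne_zero_exists {β : ℝ} (hβ : 0 < β) : ∃ ζ, Hk β 1 ζ ≠ 0 := by
  by_contra! h
  have h0 := Hk_ibp hβ 1 0
  have h00 := Hk_ibp hβ 0 0
  simp [h] at h00

lemma exists_good_line {β : ℝ} (hβ : 0 < β) :
    ∃ δ > (0:ℝ), ∀ ζ : ℂ, ζ.re = -δ → Hk β 1 ζ ≠ 0 := by
  obtain ⟨x, hx⟩ := Hk_ne_zero_exists hβ
  have hcd := ((Hk_differentiable hβ 1).differentiableOn.analyticOnNhd
    isOpen_univ).preimage_zero_mem_codiscrete hx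
  rw [Set.preimage_compl, compl_mem_codiscrete_iff] at hcd
  have hc : (Hk β 1 ⁻¹' {0}).Countable :=
    (HereditarilyLindelofSpace.isLindelof _).countable_of_isDiscrete hcd.2
  have hc2 := hc.image (fun ζ => -ζ.re)
  have hu : ¬ (Set.Ioi (0:ℝ)).Countable := by
    intro h
    have := h.measure_zero volume
    simp at this
  have : ¬ (Set.Ioi (0:ℝ) ⊆ (fun ζ : ℂ => -ζ.re) '' (Hk β 1 ⁻¹' {0})) := fun h => hu (hc2.mono h)
  obtain ⟨δ, hδ, hn⟩ := Set.not_subset.1 this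
  exact ⟨δ, hδ, fun ζ hζ h0 => hn ⟨ζ, h0, by simp [hζ]⟩⟩

/-- A point of the vertical line of abscissa `-δ`. -/
noncomputable def zl (δ τ : ℝ) : ℂ := ((-δ : ℝ) : ℂ) + I * (τ : ℂ)

lemma zl_continuous (δ : ℝ) : Continuous (zl δ) := by unfold zl; fun_prop

lemma zl_re (δ τ : ℝ) : (zl δ τ).re = -δ := by simp [zl]

lemma zl_normSq (δ τ : ℝ) : ‖zl δ τ‖ ^ 2 = δ ^ 2 + τ ^ 2 := by
  rw [← Complex.normSq_eq_norm_sq, Complex.normSq_apply]; simp [zl]; ring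

lemma zl_quad_norm (δ τ Ω : ℝ) : ‖zl δ τ ^ 2 + (Ω:ℂ) ^ 2‖ ^ 2 =
    (δ ^ 2 + (τ - Ω) ^ 2) * (δ ^ 2 + (τ + Ω) ^ 2) := by
  have : zl δ τ ^ 2 + (Ω:ℂ) ^ 2 = zl δ (τ - Ω) * zl δ (τ + Ω) := by
    simp only [zl]; push_cast; linear_combination (Ω^2) * I_sq
  rw [this, norm_mul, mul_pow, zl_normSq, zl_normSq]

lemma uv_inv {δ Ω τ : ℝ} (hδ : 0 < δ) (hΩ : 0 < Ω) :
    ((δ ^ 2 + (τ - Ω) ^ 2) * (δ ^ 2 + (τ + Ω) ^ 2))⁻¹ ≤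
      ((δ ^ 2 + (τ - Ω) ^ 2)⁻¹ + (δ ^ 2 + (τ + Ω) ^ 2)⁻¹) / (2 * Ω ^ 2) := by
  have hu : 0 < δ ^ 2 + (τ - Ω) ^ 2 := by positivity
  have hv : 0 < δ ^ 2 + (τ + Ω) ^ 2 := by positivity
  have h : 2 * Ω ^ 2 ≤ (δ ^ 2 + (τ - Ω) ^ 2) + (δ ^ 2 + (τ + Ω) ^ 2) := by
    nlinarith [sq_nonneg δ, sq_nonneg τ]
  generalize δ ^ 2 + (τ - Ω) ^ 2 = u at *
  generalize δ ^ 2 + (τ + Ω) ^ 2 = v at *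
  rw [le_div_iff₀ (by positivity)]
  have : u⁻¹ + v⁻¹ = (u * v)⁻¹ * (u + v) := by field_simp; ring
  rw [this]
  gcongr

lemma uv_ge {δ Ω τ : ℝ} :
    δ ^ 2 * Ω ^ 2 ≤ (δ ^ 2 + (τ - Ω) ^ 2) * (δ ^ 2 + (τ + Ω) ^ 2) := by
  nlinarith [sq_nonneg (δ^2), mul_nonneg (sq_nonneg δ) (sq_nonneg τ), sq_nonneg ((τ-Ω)*(τ+Ω)),
    mul_nonneg (sq_nonneg δ) (sq_nonneg Ω)]

lemma integrable_lor {δ : ℝ} (hδ : 0 < δ) : Integrable (fun τ : ℝ => (δ ^ 2 + τ ^ 2)⁻¹) := by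
  have h := (integrable_inv_one_add_sq.comp_div hδ.ne').const_mul ((δ^2)⁻¹)
  refine h.congr (Filter.Eventually.of_forall fun τ => ?_)
  simp only
  rw [← mul_inv]; congr 1; field_simp

lemma integrable_lor_sub {δ : ℝ} (hδ : 0 < δ) (c : ℝ) :
    Integrable (fun τ : ℝ => (δ ^ 2 + (τ - c) ^ 2)⁻¹) := (integrable_lor hδ).comp_sub_right c

lemma integrable_lor_add {δ : ℝ} (hδ : 0 < δ) (c : ℝ) :
    Integrable (fun τ : ℝ => (δ ^ 2 + (τ + c) ^ 2)⁻¹) := (integrable_lor hδ).comp_add_right c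

lemma quad_ne {δ Ω τ : ℝ} (hδ : 0 < δ) : zl δ τ ^ 2 + (Ω:ℂ) ^ 2 ≠ 0 := by
  intro h
  have := zl_quad_norm δ τ Ω
  rw [h] at this
  have h1 : 0 < (δ ^ 2 + (τ - Ω) ^ 2) * (δ ^ 2 + (τ + Ω) ^ 2) := by positivity
  rw [norm_zero] at this
  linarith

lemma integrable_quad {δ Ω : ℝ} (hδ : 0 < δ) :
    Integrable (fun τ : ℝ => (zl δ τ ^ 2 + (Ω:ℂ) ^ 2)⁻¹) := by
  refine Integrable.mono' ((integrable_lor_sub hδ Ω).add (integrable_lor_add hδ Ω)) ?_ ?_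
  · refine Continuous.aestronglyMeasurable ?_
    exact ((zl_continuous δ).pow 2 |>.add continuous_const).inv₀ fun τ => quad_ne hδ
  · refine Filter.Eventually.of_forall fun τ => ?_
    simp only [Pi.add_apply]
    have h := zl_quad_norm δ τ Ω
    have hu : 0 < δ ^ 2 + (τ - Ω) ^ 2 := by positivity
    have hv : 0 < δ ^ 2 + (τ + Ω) ^ 2 := by positivity
    rw [norm_inv]
    generalize δ ^ 2 + (τ - Ω) ^ 2 = u at *
    generalize δ ^ 2 + (τ + Ω) ^ 2 = v at *
    have hu' : 0 < u⁻¹ := by positivity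
    have hv' : 0 < v⁻¹ := by positivity
    have h2 : (‖zl δ τ ^ 2 + (Ω:ℂ) ^ 2‖⁻¹) ^ 2 = u⁻¹ * v⁻¹ := by
      rw [inv_pow, h, mul_inv]
    refine le_of_sq_le_sq ?_ (by positivity) 
    rw [h2]
    nlinarith

open FourierTransform in
lemma quad_int_zero {δ Ω x : ℝ} (hδ : 0 < δ) (hΩ : 0 < Ω) (hx : 0 ≤ x) :
    ∫ τ : ℝ, cexp (I * τ * x) * (zl δ τ ^ 2 + (Ω:ℂ) ^ 2)⁻¹ = 0 := by
  let g : ℝ → ℂ := fun s => cexp (-(δ:ℂ) * s) *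
    (cexp (I * Ω * (max s 0 : ℝ)) - cexp (-(I * Ω * (max s 0 : ℝ))))
  have hgc : Continuous g := by
    have : Continuous fun s : ℝ => max s 0 := by fun_prop
    fun_prop
  have hg0 : ∀ s ≤ 0, g s = 0 := fun s hs => by simp [g, max_eq_right hs]
  have hgi : g = Set.indicator (Set.Ioi 0) (fun s : ℝ => cexp ((-δ + I * Ω) * s)
      - cexp ((-δ - I * Ω) * s)) := by
    funext s
    by_cases hs : 0 < s
    · rw [Set.indicator_of_mem (by exact hs)]
      simp only [g, max_eq_left hs.le, mul_sub, ← Complex.exp_add]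
      congr 2 <;> ring
    · rw [Set.indicator_of_notMem (by exact hs), hg0 s (not_lt.1 hs)]
  have hI : ∀ a : ℂ, a.re < 0 → IntegrableOn (fun s : ℝ => cexp (a * s)) (Set.Ioi 0) :=
    fun a ha => integrableOn_exp_mul_complex_Ioi ha 0
  have hgint : Integrable g := by
    rw [hgi, integrable_indicator_iff measurableSet_Ioi]
    exact (hI _ (by simp [hδ])).sub (hI _ (by simp [hδ]))
  have hF : ∀ v : ℝ, 𝓕 g v = (2 * I * Ω) * (zl δ (-(2 * Real.pi * v)) ^ 2 + (Ω:ℂ) ^ 2)⁻¹ := by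
    intro v
    rw [Real.fourier_eq']
    have : ∀ s : ℝ, cexp (((-2 * Real.pi * inner ℝ s v : ℝ) : ℂ) * I) • g s =
      Set.indicator (Set.Ioi 0) (fun s : ℝ =>
        cexp ((-δ + I * Ω - I * (2 * Real.pi * v)) * s)
         - cexp ((-δ - I * Ω - I * (2 * Real.pi * v)) * s)) s := by
      intro s
      rw [hgi]
      by_cases hs : 0 < s
      · rw [Set.indicator_of_mem (by exact hs), Set.indicator_of_mem (by exact hs), smul_eq_mul,
          mul_sub, ← Complex.exp_add, ← Complex.exp_add]
        simp only [RCLike.inner_apply, conj_trivial]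
        push_cast
        congr 2 <;> ring
      · rw [Set.indicator_of_notMem (by exact hs), Set.indicator_of_notMem (by exact hs), smul_zero]
    simp_rw [this]
    have r1 : (-δ + I * Ω - I * (2 * Real.pi * v) : ℂ).re < 0 := by simp [hδ]
    have r2 : (-δ - I * Ω - I * (2 * Real.pi * v) : ℂ).re < 0 := by simp [hδ]
    rw [integral_indicator measurableSet_Ioi, integral_sub (hI _ r1) (hI _ r2),
      integral_exp_mul_complex_Ioi r1, integral_exp_mul_complex_Ioi r2]
    have n1 : (-δ + I * Ω - I * (2 * Real.pi * v) : ℂ) ≠ 0 := by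
      intro h; rw [h] at r1; simp at r1
    have n2 : (-δ - I * Ω - I * (2 * Real.pi * v) : ℂ) ≠ 0 := by
      intro h; rw [h] at r2; simp at r2
    have e : zl δ (-(2 * Real.pi * v)) ^ 2 + (Ω:ℂ) ^ 2 =
      (-δ + I * Ω - I * (2 * Real.pi * v)) * (-δ - I * Ω - I * (2 * Real.pi * v)) := by
      simp only [zl]; push_cast; linear_combination (Ω^2) * I_sq
    rw [e]
    simp only [ofReal_zero, mul_zero, Complex.exp_zero]
    have e2 : (2 * I * Ω : ℂ) = (-δ + I * Ω - I * (2 * Real.pi * v))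
      - (-δ - I * Ω - I * (2 * Real.pi * v)) := by ring
    rw [e2]
    generalize (-δ + I * Ω - I * (2 * Real.pi * v) : ℂ) = a at n1
    generalize (-δ - I * Ω - I * (2 * Real.pi * v) : ℂ) = b at n2
    field_simp
    ring
  have hFi : Integrable (𝓕 g) := by
    have h1 := (integrable_quad (Ω := Ω) hδ).comp_mul_left' (R := -(2 * Real.pi))
      (by simp [Real.pi_ne_zero])
    refine (h1.const_mul (2 * I * Ω)).congr (Filter.Eventually.of_forall fun v => ?_)
    simp only [hF]
    simp
  have hinv := congrFun (hgc.fourierInv_fourier_eq hgint hFi) (-x)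
  rw [hg0 _ (by linarith), Real.fourierInv_eq'] at hinv
  have h3 := Measure.integral_comp_mul_left
    (fun τ : ℝ => cexp (I * τ * x) * (zl δ τ ^ 2 + (Ω:ℂ) ^ 2)⁻¹) (-(2 * Real.pi))
  have h4 : (∫ v : ℝ, cexp (((2 * Real.pi * inner ℝ v (-x) : ℝ) : ℂ) * I) • 𝓕 g v) =
     (2 * I * Ω) * ∫ v : ℝ, (fun τ : ℝ => cexp (I * τ * x) * (zl δ τ ^ 2 + (Ω:ℂ) ^ 2)⁻¹)
       (-(2 * Real.pi) * v) := by
    rw [← integral_const_mul]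
    refine integral_congr_ae (Filter.Eventually.of_forall fun v => ?_)
    simp only [hF, smul_eq_mul, RCLike.inner_apply, conj_trivial]
    rw [mul_left_comm]
    congr 2
    · congr 1; push_cast; ring
    · rw [neg_mul]
  rw [h4, h3] at hinv
  have hne : (2 * I * Ω : ℂ) ≠ 0 := by simp [hΩ.ne']
  rcases mul_eq_zero.1 hinv with h | h
  · exact absurd h hne
  · rcases smul_eq_zero.1 h with h | h
    · simp [Real.pi_ne_zero] at h
    · exact h

noncomputable def Pq (β w κ : ℝ) (ζ : ℂ) : ℂ := (κ:ℂ) ^ 2 * (ζ ^ 2 + 3 * β) + (w:ℂ) ^ 2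

noncomputable def Kq (β w : ℝ) (ζ : ℂ) : ℂ := (β:ℂ) ^ 2 * (w:ℂ) ^ 2 * Hk β 3 ζ

noncomputable def Om (β w κ : ℝ) : ℝ := Real.sqrt (w ^ 2 / κ ^ 2 + 3 * β)

lemma Om_sq {β w κ : ℝ} (hβ : 0 < β) : Om β w κ ^ 2 = w ^ 2 / κ ^ 2 + 3 * β :=
  Real.sq_sqrt (by positivity)

lemma Om_pos {β w κ : ℝ} (hβ : 0 < β) : 0 < Om β w κ :=
  Real.sqrt_pos.2 (by positivity)

lemma Pq_eq {β w κ : ℝ} (hβ : 0 < β) (hκ : 0 < κ) (ζ : ℂ) :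
    Pq β w κ ζ = (κ:ℂ) ^ 2 * (ζ ^ 2 + (Om β w κ : ℂ) ^ 2) := by
  have : (κ:ℂ) ≠ 0 := by exact_mod_cast hκ.ne'
  rw [← ofReal_pow (Om β w κ), Om_sq hβ, Pq]
  push_cast
  field_simp
  ring

lemma kOm {β w κ : ℝ} (hβ : 0 < β) (hκ : 0 < κ) : w ^ 2 ≤ κ ^ 2 * Om β w κ ^ 2 := by
  rw [Om_sq hβ, mul_add, mul_div_cancel₀ _ (by positivity)]
  have : 0 ≤ κ ^ 2 * (3 * β) := by positivity
  linarith

lemma Pq_norm_sq {β w κ : ℝ} (hβ : 0 < β) (hκ : 0 < κ) (δ τ : ℝ) :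
    ‖Pq β w κ (zl δ τ)‖ ^ 2 = κ ^ 4 *
      ((δ ^ 2 + (τ - Om β w κ) ^ 2) * (δ ^ 2 + (τ + Om β w κ) ^ 2)) := by
  rw [Pq_eq hβ hκ, norm_mul, mul_pow, zl_quad_norm, norm_pow, norm_real, Real.norm_eq_abs,
    abs_of_pos hκ]
  ring

lemma Pq_lower {β w κ δ : ℝ} (hβ : 0 < β) (hκ : 0 < κ) (τ : ℝ) :
    κ * δ * w ≤ ‖Pq β w κ (zl δ τ)‖ := by
  refine le_of_sq_le_sq ?_ (norm_nonneg _)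
  rw [Pq_norm_sq hβ hκ]
  calc (κ * δ * w) ^ 2 = κ ^ 2 * δ ^ 2 * w ^ 2 := by ring
    _ ≤ κ ^ 2 * δ ^ 2 * (κ ^ 2 * Om β w κ ^ 2) := by gcongr; exact kOm hβ hκ
    _ = κ ^ 4 * (δ ^ 2 * Om β w κ ^ 2) := by ring
    _ ≤ _ := mul_le_mul_of_nonneg_left uv_ge (by positivity)

lemma Pq_inv_sq {β w κ δ : ℝ} (hβ : 0 < β) (hw : 0 < w) (hκ : 0 < κ) (hδ : 0 < δ) (τ : ℝ) :
    (‖Pq β w κ (zl δ τ)‖ ^ 2)⁻¹ ≤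
      ((δ ^ 2 + (τ - Om β w κ) ^ 2)⁻¹ + (δ ^ 2 + (τ + Om β w κ) ^ 2)⁻¹) / (2 * κ ^ 2 * w ^ 2) := by
  rw [Pq_norm_sq hβ hκ, mul_inv]
  have h := uv_inv (τ := τ) hδ (Om_pos (w := w) (κ := κ) hβ)
  have h2 := kOm (w := w) hβ hκ
  have hO := Om_pos (w := w) (κ := κ) hβ
  set S := (δ ^ 2 + (τ - Om β w κ) ^ 2)⁻¹ + (δ ^ 2 + (τ + Om β w κ) ^ 2)⁻¹ with hS
  have hS0 : 0 ≤ S := by positivity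
  calc _ ≤ (κ ^ 4)⁻¹ * (S / (2 * Om β w κ ^ 2)) := by gcongr
    _ = S / (2 * κ ^ 2 * (κ ^ 2 * Om β w κ ^ 2)) := by field_simp
    _ ≤ _ := by gcongr

lemma q_norm_le {β : ℝ} (hβ : 0 < β) (ζ : ℂ) : ‖ζ ^ 2 + 3 * β‖ ≤ ‖ζ‖ ^ 2 + 3 * β := by
  refine (norm_add_le _ _).trans ?_
  simp [abs_of_pos hβ]

lemma Pq_near {β w κ : ℝ} (hβ : 0 < β) {ζ : ℂ} (h1 : 3 * β * κ ^ 2 ≤ w ^ 2 / 4)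
    (h2 : κ ^ 2 * ‖ζ‖ ^ 2 ≤ w ^ 2 / 4) :
    w ^ 2 / 2 ≤ ‖Pq β w κ ζ‖ ∧ ‖Pq β w κ ζ‖ ≤ 3 / 2 * w ^ 2 := by
  have e1 : ‖(κ:ℂ) ^ 2 * (ζ ^ 2 + 3 * β)‖ ≤ w ^ 2 / 2 := by
    rw [norm_mul, norm_pow, norm_real, Real.norm_eq_abs, sq_abs]
    have : κ ^ 2 * ‖ζ ^ 2 + 3 * β‖ ≤ κ ^ 2 * (‖ζ‖ ^ 2 + 3 * β) := by gcongr; exact q_norm_le hβ ζ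
    linarith
  have e2 : ‖(w:ℂ) ^ 2‖ = w ^ 2 := by
    rw [norm_pow, norm_real, Real.norm_eq_abs, sq_abs]
  have e3 := norm_add_le ((κ:ℂ) ^ 2 * (ζ ^ 2 + 3 * β)) ((w:ℂ)^2)
  have e4 := norm_sub_le (Pq β w κ ζ) ((κ:ℂ) ^ 2 * (ζ ^ 2 + 3 * β))
  have e5 : Pq β w κ ζ - (κ:ℂ) ^ 2 * (ζ ^ 2 + 3 * β) = (w:ℂ)^2 := by rw [Pq]; ring
  rw [e5] at e4
  constructor
  · linarith
  · rw [Pq]; linarith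

lemma lemA {β w κ δ : ℝ} (hβ : 0 < β) (hw : 0 < w) (hκ : 0 < κ) (hδ : 0 < δ)
    (h1 : 3 * β * κ ^ 2 ≤ w ^ 2 / 4) (τ : ℝ) :
    (δ ^ 2 + τ ^ 2)⁻¹ * (‖Pq β w κ (zl δ τ)‖ ^ 2)⁻¹ ≤ 4 / w ^ 4 * ((δ ^ 2 + τ ^ 2)⁻¹ +
      ((δ ^ 2 + (τ - Om β w κ) ^ 2)⁻¹ + (δ ^ 2 + (τ + Om β w κ) ^ 2)⁻¹)) := by
  have hN := zl_normSq δ τ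
  have hinv := Pq_inv_sq hβ hw hκ hδ τ
  set S := (δ ^ 2 + (τ - Om β w κ) ^ 2)⁻¹ + (δ ^ 2 + (τ + Om β w κ) ^ 2)⁻¹ with hS
  have hS0 : 0 ≤ S := by positivity
  by_cases h2 : κ ^ 2 * ‖zl δ τ‖ ^ 2 ≤ w ^ 2 / 4
  · have h3 := (Pq_near hβ h1 h2).1
    have h4 : (‖Pq β w κ (zl δ τ)‖ ^ 2)⁻¹ ≤ 4 / w ^ 4 := by
      calc _ ≤ ((w ^ 2 / 2) ^ 2)⁻¹ := by gcongr
        _ = _ := by field_simp; norm_num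
    calc _ ≤ (δ ^ 2 + τ ^ 2)⁻¹ * (4 / w ^ 4) := by gcongr
      _ = 4 / w ^ 4 * ((δ ^ 2 + τ ^ 2)⁻¹ + 0) := by ring
      _ ≤ _ := by gcongr
  · push Not at h2
    rw [hN] at h2
    have h4 : (δ ^ 2 + τ ^ 2)⁻¹ ≤ 4 * κ ^ 2 / w ^ 2 := by
      rw [inv_le_comm₀ (by positivity) (by positivity), inv_div, div_le_iff₀ (by positivity)]
      linarith
    have hpos : 0 ≤ (δ ^ 2 + τ ^ 2)⁻¹ := by positivity
    calc _ ≤ (4 * κ ^ 2 / w ^ 2) * (S / (2 * κ ^ 2 * w ^ 2)) := by gcongr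
      _ = 2 / w ^ 4 * S := by field_simp; ring
      _ ≤ 4 / w ^ 4 * ((δ ^ 2 + τ ^ 2)⁻¹ + S) := by gcongr <;> linarith

lemma Kq_bound {β : ℝ} (hβ : 0 < β) (w δ : ℝ) :
    ∃ C > (0:ℝ), ∀ τ, ‖zl δ τ‖ ^ 4 * ‖Kq β w (zl δ τ)‖ ≤ C := by
  obtain ⟨C, hC⟩ := Hk_decay hβ δ 4 3 (by norm_num)
  refine ⟨β ^ 2 * w ^ 2 * |C| + 1, by positivity, fun τ => ?_⟩
  have := hC (zl δ τ) (by rw [zl_re]; simp)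
  have e : ‖Kq β w (zl δ τ)‖ = β ^ 2 * w ^ 2 * ‖Hk β 3 (zl δ τ)‖ := by
    simp [Kq]
  rw [e]
  calc _ = β ^ 2 * w ^ 2 * (‖zl δ τ‖ ^ 4 * ‖Hk β 3 (zl δ τ)‖) := by ring
    _ ≤ β ^ 2 * w ^ 2 * |C| := by gcongr; exact this.trans (le_abs_self C)
    _ ≤ _ := by linarith

lemma q_ne {β δ : ℝ} (hβ : 0 < β) (hδ : 0 < δ) (τ : ℝ) : zl δ τ ^ 2 + 3 * (β:ℂ) ≠ 0 := by
  have h := quad_ne (Ω := Real.sqrt (3 * β)) (τ := τ) hδ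
  rw [← ofReal_pow, Real.sq_sqrt (by positivity)] at h
  push_cast at h
  exact h

lemma wK_eq {β : ℝ} (hβ : 0 < β) (w : ℝ) (ζ : ℂ) :
    (w:ℂ) ^ 2 + Kq β w ζ = (w:ℂ) ^ 2 * ((ζ ^ 2 + 3 * β) * Hk β 1 ζ) := by
  rw [Hk_key hβ, Kq]; ring

lemma PK_eq {β : ℝ} (hβ : 0 < β) (w κ : ℝ) (ζ : ℂ) :
    Pq β w κ ζ + Kq β w ζ = (ζ ^ 2 + 3 * β) * ((κ:ℂ) ^ 2 + (w:ℂ) ^ 2 * Hk β 1 ζ) := by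
  have := wK_eq hβ w ζ
  rw [Pq]; linear_combination this

lemma lemB {β w δ : ℝ} (hβ : 0 < β) (hw : 0 < w) (hδ : 0 < δ)
    (hne : ∀ ζ : ℂ, ζ.re = -δ → Hk β 1 ζ ≠ 0) :
    ∃ c > (0:ℝ), ∀ᶠ κ in nhdsWithin (0:ℝ) (Set.Ioi 0), 3 * β * κ ^ 2 ≤ w ^ 2 / 4 ∧
      ∀ τ, c * ‖Pq β w κ (zl δ τ)‖ ≤ ‖Pq β w κ (zl δ τ) + Kq β w (zl δ τ)‖ := by
  obtain ⟨C, hC0, hC⟩ := Kq_bound hβ w δ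
  set M : ℝ := 1 + 4 * C / w ^ 2 with hM
  have hM1 : 1 ≤ M := by
    have : 0 ≤ 4 * C / w ^ 2 := by positivity
    linarith
  have hM4 : C ≤ w ^ 2 / 4 * M ^ 4 := by
    have h1 : M ≤ M ^ 4 := le_self_pow₀ hM1 (by norm_num)
    have h2 : w ^ 2 / 4 * M = w ^ 2 / 4 + C := by rw [hM]; field_simp
    have h3 : w ^ 2 / 4 * M ≤ w ^ 2 / 4 * M ^ 4 := by gcongr
    have h4 : 0 ≤ w ^ 2 / 4 := by positivity
    linarith
  have hcont : Continuous fun τ => ‖(w:ℂ) ^ 2 + Kq β w (zl δ τ)‖ := by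
    have : Continuous fun τ => Hk β 3 (zl δ τ) :=
      (Hk_differentiable hβ 3).continuous.comp (zl_continuous δ)
    unfold Kq
    fun_prop
  obtain ⟨τ₀, -, hτ₀⟩ := (isCompact_Icc (a := -M) (b := M)).exists_isMinOn
    ⟨0, by constructor <;> linarith⟩ hcont.continuousOn
  set c₀ := ‖(w:ℂ) ^ 2 + Kq β w (zl δ τ₀)‖ with hc₀
  have hc₀pos : 0 < c₀ := by
    rw [hc₀, norm_pos_iff, wK_eq hβ]
    have : (w:ℂ) ≠ 0 := by exact_mod_cast hw.ne'
    exact mul_ne_zero (pow_ne_zero 2 this) (mul_ne_zero (q_ne hβ hδ τ₀) (hne _ (zl_re δ τ₀)))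
  refine ⟨min (1/2) (c₀ / (3 * w ^ 2)), by positivity, ?_⟩
  have ev : ∀ (a b : ℝ) (n : ℕ), n ≠ 0 → 0 < b → 
      ∀ᶠ κ in nhdsWithin (0:ℝ) (Set.Ioi 0), a * κ ^ n ≤ b := by
    intro a b n hn hb
    have : Filter.Tendsto (fun κ : ℝ => a * κ ^ n) (nhds 0) (nhds 0) := by
      refine Continuous.tendsto' (by fun_prop) _ _ (by simp [hn])
    exact nhdsWithin_le_nhds ((this.eventually_lt_const hb).mono fun _ h => h.le)
  filter_upwards [ev (3 * β) (w ^ 2 / 4) 2 (by norm_num) (by positivity),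
    ev (16 * C) (δ * w ^ 5 / 2) 3 (by norm_num) (by positivity),
    ev (M ^ 2 + 3 * β) (c₀ / 2) 2 (by norm_num) (by positivity), self_mem_nhdsWithin]
    with κ k1 k2 k3 hκ
  replace hκ : 0 < κ := hκ
  refine ⟨k1, fun τ => ?_⟩
  have half : ‖Kq β w (zl δ τ)‖ ≤ ‖Pq β w κ (zl δ τ)‖ / 2 →
      min (1/2) (c₀ / (3 * w ^ 2)) * ‖Pq β w κ (zl δ τ)‖ ≤
        ‖Pq β w κ (zl δ τ) + Kq β w (zl δ τ)‖ := by
    intro h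
    have h1 : ‖Pq β w κ (zl δ τ)‖ - ‖Kq β w (zl δ τ)‖ ≤ ‖Pq β w κ (zl δ τ) + Kq β w (zl δ τ)‖ := by
      simpa using norm_sub_norm_le (Pq β w κ (zl δ τ)) (-Kq β w (zl δ τ))
    have h2 : min (1/2) (c₀ / (3 * w ^ 2)) * ‖Pq β w κ (zl δ τ)‖ ≤ 1/2 * ‖Pq β w κ (zl δ τ)‖ := by
      gcongr; exact min_le_left _ _
    linarith
  have hCτ := hC τ
  by_cases hnear : κ ^ 2 * ‖zl δ τ‖ ^ 2 ≤ w ^ 2 / 4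
  · obtain ⟨p1, p2⟩ := Pq_near hβ k1 hnear
    by_cases hNM : M ≤ ‖zl δ τ‖
    · apply half
      have h5 : M ^ 4 * ‖Kq β w (zl δ τ)‖ ≤ M ^ 4 * (w ^ 2 / 4) := by
        have : M ^ 4 * ‖Kq β w (zl δ τ)‖ ≤ ‖zl δ τ‖ ^ 4 * ‖Kq β w (zl δ τ)‖ := by gcongr
        linarith
      have := le_of_mul_le_mul_left h5 (by positivity)
      linarith
    · push Not at hNM
      have hτM : |τ| ≤ M := by
        have h6 : ‖zl δ τ‖ ^ 2 ≤ M ^ 2 := by gcongr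
        rw [zl_normSq] at h6
        exact abs_le_of_sq_le_sq (by nlinarith [sq_nonneg δ]) (by linarith)
      have h7 : c₀ ≤ ‖(w:ℂ) ^ 2 + Kq β w (zl δ τ)‖ := hτ₀ (Set.mem_Icc.2 (abs_le.1 hτM))
      have h8 : ‖(κ:ℂ) ^ 2 * (zl δ τ ^ 2 + 3 * β)‖ ≤ c₀ / 2 := by
        rw [norm_mul, norm_pow, norm_real, Real.norm_eq_abs, sq_abs]
        refine le_trans ?_ k3
        rw [mul_comm]
        gcongr
        exact (q_norm_le hβ _).trans (by gcongr)
      have h9 : Pq β w κ (zl δ τ) + Kq β w (zl δ τ) = ((w:ℂ) ^ 2 + Kq β w (zl δ τ))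
          - (-((κ:ℂ) ^ 2 * (zl δ τ ^ 2 + 3 * β))) := by rw [Pq]; ring
      have h10 := norm_sub_norm_le ((w:ℂ) ^ 2 + Kq β w (zl δ τ))
        (-((κ:ℂ) ^ 2 * (zl δ τ ^ 2 + 3 * β)))
      rw [← h9, norm_neg] at h10
      calc _ ≤ c₀ / (3 * w ^ 2) * (3 / 2 * w ^ 2) := by
            gcongr
            exact min_le_right _ _
        _ = c₀ / 2 := by field_simp
        _ ≤ _ := by linarith
  · push Not at hnear
    apply half
    have hP := Pq_lower (w := w) (δ := δ) hβ hκ τ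
    have h5 : (w ^ 2 / 4) ^ 2 * ‖Kq β w (zl δ τ)‖ ≤ κ ^ 4 * C := by
      calc _ ≤ (κ ^ 2 * ‖zl δ τ‖ ^ 2) ^ 2 * ‖Kq β w (zl δ τ)‖ := by gcongr
        _ = κ ^ 4 * (‖zl δ τ‖ ^ 4 * ‖Kq β w (zl δ τ)‖) := by ring
        _ ≤ _ := by gcongr
    have h6 : κ ^ 4 * C ≤ (w ^ 2 / 4) ^ 2 * (κ * δ * w / 2) := by
      have := mul_le_mul_of_nonneg_left k2 hκ.le
      linarith
    have := le_of_mul_le_mul_left (h5.trans h6) (by positivity)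
    linarith

lemma disp_eq {n₀ β w : ℝ} (hn : 0 < n₀) (z : ℂ) (κ : ℝ) :
    disp n₀ β w z κ = -((w:ℂ) ^ 2 / (κ:ℂ) ^ 2) * Hk β 1 (z / κ) := by
  have hn' : (n₀:ℂ) ≠ 0 := by exact_mod_cast hn.ne'
  have : ∀ s : ℝ, ((s : ℝ) : ℂ) * ((Fmax n₀ β s : ℝ) : ℂ) *
      Complex.exp (-(z / (κ : ℂ)) * ((s : ℝ) : ℂ)) = (n₀:ℂ) * momInt β 1 (z / κ) s := by
    intro s
    have e : -((β / 2 : ℝ) : ℂ) * (s : ℂ) ^ 2 - (z / κ) * (s : ℂ) =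
      ((-β * s ^ 2 / 2 : ℝ) : ℂ) + -(z / (κ : ℂ)) * (s : ℂ) := by push_cast; ring
    rw [momInt, e, Complex.exp_add, Fmax]
    push_cast
    ring
  unfold disp
  simp_rw [this]
  rw [integral_const_mul, ← Hk]
  push_cast
  field_simp

/-- The rescaled symbol on the line. -/
noncomputable def Psi (β w κ : ℝ) (ζ : ℂ) : ℂ :=
  (-((w:ℂ) ^ 2 / (κ:ℂ) ^ 2) * Hk β 1 ζ) / (1 - (-((w:ℂ) ^ 2 / (κ:ℂ) ^ 2) * Hk β 1 ζ))

lemma line_div {κ : ℝ} (hκ : 0 < κ) (δ ω : ℝ) :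
    (((-δ * κ : ℝ) : ℂ) + Complex.I * (ω : ℂ)) / κ = zl δ (ω / κ) := by
  have : (κ:ℂ) ≠ 0 := by exact_mod_cast hκ.ne'
  rw [zl]; push_cast; field_simp

lemma one_sub_eq {β : ℝ} (hβ : 0 < β) (w : ℝ) {κ : ℝ} (hκ : 0 < κ) (ζ : ℂ) :
    (κ:ℂ) ^ 2 * (ζ ^ 2 + 3 * β) * (1 - (-((w:ℂ) ^ 2 / (κ:ℂ) ^ 2) * Hk β 1 ζ)) =
      Pq β w κ ζ + Kq β w ζ := by
  have : (κ:ℂ) ≠ 0 := by exact_mod_cast hκ.ne'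
  rw [PK_eq hβ]; field_simp; ring

lemma Psi_eq {β : ℝ} (hβ : 0 < β) (w : ℝ) {κ : ℝ} (hκ : 0 < κ) {ζ : ℂ}
    (hP : Pq β w κ ζ ≠ 0) (hPK : Pq β w κ ζ + Kq β w ζ ≠ 0) :
    Psi β w κ ζ + (w:ℂ) ^ 2 * (Pq β w κ ζ)⁻¹ =
      -((κ:ℂ) ^ 2 * (Kq β w ζ * (ζ ^ 2 + 3 * β)) / (Pq β w κ ζ * (Pq β w κ ζ + Kq β w ζ))) := by
  have hk : (κ:ℂ) ≠ 0 := by exact_mod_cast hκ.ne'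
  have h1 := one_sub_eq hβ w hκ ζ
  have hne : (κ:ℂ) ^ 2 * (ζ ^ 2 + 3 * β) ≠ 0 := by
    intro h; rw [h, zero_mul] at h1; exact hPK h1.symm
  have h2 : Psi β w κ ζ = -((w:ℂ)^2 + Kq β w ζ) / (Pq β w κ ζ + Kq β w ζ) := by
    rw [Psi, ← mul_div_mul_left _ _ hne, h1, wK_eq hβ]
    congr 1
    field_simp
  have h3 : (κ:ℂ) ^ 2 * (ζ ^ 2 + 3 * β) = Pq β w κ ζ - (w:ℂ)^2 := by rw [Pq]; ring
  rw [h2, mul_left_comm, h3]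
  field_simp
  ring

lemma Pq_inv_int {β w κ δ : ℝ} (hβ : 0 < β) (hκ : 0 < κ) (hδ : 0 < δ) :
    Integrable (fun τ : ℝ => (Pq β w κ (zl δ τ))⁻¹) := by
  simp_rw [Pq_eq hβ hκ, mul_inv]
  exact (integrable_quad hδ).const_mul _

lemma Pq_int_zero {β w κ δ x : ℝ} (hβ : 0 < β) (hκ : 0 < κ) (hδ : 0 < δ) (hx : 0 ≤ x) :
    ∫ τ : ℝ, cexp (zl δ τ * x) * (Pq β w κ (zl δ τ))⁻¹ = 0 := by
  have h := quad_int_zero hδ (Om_pos (w := w) (κ := κ) hβ) hx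
  have : ∀ τ : ℝ, cexp (zl δ τ * x) * (Pq β w κ (zl δ τ))⁻¹ =
      (cexp (-(δ:ℂ) * x) * ((κ:ℂ)^2)⁻¹) *
        (cexp (I * τ * x) * (zl δ τ ^ 2 + (Om β w κ:ℂ) ^ 2)⁻¹) := by
    intro τ
    have e : zl δ τ * x = -(δ:ℂ) * x + I * τ * x := by rw [zl]; push_cast; ring
    rw [Pq_eq hβ hκ, mul_inv, e, Complex.exp_add]
    ring
  simp_rw [this]
  rw [integral_const_mul, h, mul_zero]

/-- **Bound on the remainder (non-Klein-Gordon) part of the resolvent kernel at low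
frequencies** (Lemma 2.8). -/
theorem remainder_resolvent_kernel_bound_low_frequency
    (n₀ β ωp : ℝ) (hn : 0 < n₀) (hβ : 0 < β) (hω : 0 < ωp) :
    ∃ δ' > (0:ℝ), ∃ ν₀ > (0:ℝ), ∃ lam₀ > (0:ℝ), ∃ C > (0:ℝ),
      ∀ κ ∈ Set.Ioo (0:ℝ) ν₀,
        (∀ ω : ℝ,
          1 - disp n₀ β ωp (((-δ' * κ : ℝ) : ℂ) + Complex.I * (ω : ℂ)) κ ≠ 0) ∧
        Integrable (fun ω : ℝ =>
          disp n₀ β ωp (((-δ' * κ : ℝ) : ℂ) + Complex.I * (ω : ℂ)) κ /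
            (1 - disp n₀ β ωp (((-δ' * κ : ℝ) : ℂ) + Complex.I * (ω : ℂ)) κ)) ∧
        ∀ t : ℝ, 0 ≤ t →
          ‖((2 * Real.pi : ℝ) : ℂ)⁻¹ * ∫ ω : ℝ,
              Complex.exp ((((-δ' * κ : ℝ) : ℂ) + Complex.I * (ω : ℂ)) * ((t : ℝ) : ℂ)) *
                (disp n₀ β ωp (((-δ' * κ : ℝ) : ℂ) + Complex.I * (ω : ℂ)) κ /
                  (1 - disp n₀ β ωp (((-δ' * κ : ℝ) : ℂ) + Complex.I * (ω : ℂ)) κ))‖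
            ≤ C * κ ^ 3 * Real.exp (-lam₀ * κ * t) := by
  obtain ⟨δ, hδ, hne⟩ := exists_good_line hβ
  obtain ⟨c, hc, hev⟩ := lemB (w := ωp) hβ hω hδ hne
  obtain ⟨CK, hCK0, hCK⟩ := Kq_bound hβ ωp δ
  obtain ⟨ν, hν, hsub⟩ := mem_nhdsGT_iff_exists_Ioo_subset.1 hev
  set J : ℝ := ∫ τ : ℝ, (δ ^ 2 + τ ^ 2)⁻¹ with hJ
  have hJ0 : 0 ≤ J := integral_nonneg fun τ => by positivity
  set B : ℝ := CK * (1 + 3 * β / δ ^ 2) / c * (4 / ωp ^ 4) with hB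
  have hB0 : 0 < B := by positivity
  refine ⟨δ, hδ, ν, hν, δ, hδ, B * (3 * J) + 1, by positivity, fun κ hκ' => ?_⟩
  have hκ : 0 < κ := hκ'.1
  obtain ⟨hsm, hPK⟩ := hsub hκ'
  have hPpos : ∀ τ, 0 < ‖Pq β ωp κ (zl δ τ)‖ := fun τ =>
    lt_of_lt_of_le (by positivity) (Pq_lower (δ := δ) hβ hκ τ)
  have hP0 : ∀ τ, Pq β ωp κ (zl δ τ) ≠ 0 := fun τ => norm_pos_iff.1 (hPpos τ)
  have hPK0 : ∀ τ, Pq β ωp κ (zl δ τ) + Kq β ωp (zl δ τ) ≠ 0 := fun τ =>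
    norm_pos_iff.1 (lt_of_lt_of_le (mul_pos hc (hPpos τ)) (hPK τ))
  have hone : ∀ τ, 1 - (-((ωp:ℂ) ^ 2 / (κ:ℂ) ^ 2) * Hk β 1 (zl δ τ)) ≠ 0 := by
    intro τ h
    have := one_sub_eq hβ ωp hκ (zl δ τ)
    rw [h, mul_zero] at this
    exact hPK0 τ this.symm
  have hH : Continuous fun τ => Hk β 1 (zl δ τ) :=
    (Hk_differentiable hβ 1).continuous.comp (zl_continuous δ)
  have hPsic : Continuous fun τ => Psi β ωp κ (zl δ τ) := by
    unfold Psi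
    exact Continuous.div (by fun_prop) (by fun_prop) hone
  have hPinv := Pq_inv_int (w := ωp) hβ hκ hδ
  have hPinvc : Continuous fun τ => (Pq β ωp κ (zl δ τ))⁻¹ := by
    refine Continuous.inv₀ ?_ hP0
    have := zl_continuous δ
    unfold Pq; fun_prop
  set D : ℝ → ℂ := fun τ => Psi β ωp κ (zl δ τ) + (ωp:ℂ) ^ 2 * (Pq β ωp κ (zl δ τ))⁻¹ with hD
  have hDc : Continuous D := hPsic.add (continuous_const.mul hPinvc)
  set G : ℝ → ℝ := fun τ => κ ^ 2 * B * ((δ ^ 2 + τ ^ 2)⁻¹ +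
      ((δ ^ 2 + (τ - Om β ωp κ) ^ 2)⁻¹ + (δ ^ 2 + (τ + Om β ωp κ) ^ 2)⁻¹)) with hG
  have i1 := integrable_lor hδ
  have i2 := integrable_lor_sub hδ (Om β ωp κ)
  have i3 := integrable_lor_add hδ (Om β ωp κ)
  have hGi : Integrable G := (i1.add (i2.add i3)).const_mul _
  have hGint : ∫ τ, G τ = κ ^ 2 * B * (3 * J) := by
    have e2 : ∫ τ : ℝ, (δ ^ 2 + (τ - Om β ωp κ) ^ 2)⁻¹ = J :=
      integral_sub_right_eq_self (fun τ : ℝ => (δ ^ 2 + τ ^ 2)⁻¹) _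
    have e3 : ∫ τ : ℝ, (δ ^ 2 + (τ + Om β ωp κ) ^ 2)⁻¹ = J :=
      integral_add_right_eq_self (fun τ : ℝ => (δ ^ 2 + τ ^ 2)⁻¹) _
    have i4 : Integrable fun τ : ℝ => (δ ^ 2 + (τ - Om β ωp κ) ^ 2)⁻¹ +
        (δ ^ 2 + (τ + Om β ωp κ) ^ 2)⁻¹ := i2.add i3
    rw [hG, integral_const_mul, integral_add i1 i4, integral_add i2 i3, e2, e3]
    ring
  have hDG : ∀ τ, ‖D τ‖ ≤ G τ := by
    intro τ
    have hN := zl_normSq δ τ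
    have hNpos : 0 < δ ^ 2 + τ ^ 2 := by positivity
    have hA := lemA hβ hω hκ hδ hsm τ
    have hq : ‖zl δ τ ^ 2 + 3 * β‖ ≤ (1 + 3 * β / δ ^ 2) * (δ ^ 2 + τ ^ 2) := by
      refine (q_norm_le hβ _).trans ?_
      rw [hN]
      have : 3 * β / δ ^ 2 * δ ^ 2 = 3 * β := by field_simp
      have h2 : 0 ≤ 3 * β / δ ^ 2 * τ ^ 2 := by positivity
      linarith
    have hK : ‖Kq β ωp (zl δ τ)‖ ≤ CK * ((δ ^ 2 + τ ^ 2) ^ 2)⁻¹ := by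
      have := hCK τ
      rw [← div_eq_mul_inv, le_div_iff₀ (by positivity), ← hN]
      linarith
    have hKq : ‖Kq β ωp (zl δ τ)‖ * ‖zl δ τ ^ 2 + 3 * β‖ ≤
        CK * (1 + 3 * β / δ ^ 2) * (δ ^ 2 + τ ^ 2)⁻¹ := by
      calc _ ≤ (CK * ((δ ^ 2 + τ ^ 2) ^ 2)⁻¹) * ((1 + 3 * β / δ ^ 2) * (δ ^ 2 + τ ^ 2)) := by
            gcongr
        _ = _ := by field_simp
    simp only [hD]
    rw [Psi_eq hβ ωp hκ (hP0 τ) (hPK0 τ), norm_neg, norm_div, norm_mul, norm_mul, norm_mul, norm_pow,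
      norm_real, Real.norm_eq_abs, sq_abs]
    have hp := hPpos τ
    calc _ ≤ κ ^ 2 * (CK * (1 + 3 * β / δ ^ 2) * (δ ^ 2 + τ ^ 2)⁻¹) /
          (‖Pq β ωp κ (zl δ τ)‖ * (c * ‖Pq β ωp κ (zl δ τ)‖)) := by
          gcongr
          exact hPK τ
      _ = κ ^ 2 * (CK * (1 + 3 * β / δ ^ 2) / c) *
          ((δ ^ 2 + τ ^ 2)⁻¹ * (‖Pq β ωp κ (zl δ τ)‖ ^ 2)⁻¹) := by
          field_simp
      _ ≤ κ ^ 2 * (CK * (1 + 3 * β / δ ^ 2) / c) * _ :=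
          mul_le_mul_of_nonneg_left hA (by positivity)
      _ = G τ := by simp only [hG, hB]; ring
  have hDi : Integrable D := hGi.mono' hDc.aestronglyMeasurable (Filter.Eventually.of_forall hDG)
  have hPsi_split : ∀ τ, Psi β ωp κ (zl δ τ) = D τ - (ωp:ℂ) ^ 2 * (Pq β ωp κ (zl δ τ))⁻¹ :=
    fun τ => by simp only [hD]; ring
  have hPsii : Integrable fun τ => Psi β ωp κ (zl δ τ) :=
    (hDi.sub (hPinv.const_mul ((ωp:ℂ)^2))).congr
      (Filter.Eventually.of_forall fun τ => (hPsi_split τ).symm)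
  have hfrac : ∀ ω : ℝ, disp n₀ β ωp (((-δ * κ : ℝ) : ℂ) + Complex.I * (ω : ℂ)) κ /
            (1 - disp n₀ β ωp (((-δ * κ : ℝ) : ℂ) + Complex.I * (ω : ℂ)) κ) =
            Psi β ωp κ (zl δ (ω / κ)) := by
    intro ω
    rw [disp_eq hn, line_div hκ, Psi]
  refine ⟨fun ω => ?_, ?_, fun t ht => ?_⟩
  · rw [disp_eq hn, line_div hκ]
    exact hone _
  · simp_rw [hfrac]
    exact hPsii.comp_div hκ.ne'
  · simp_rw [hfrac]
    set x : ℝ := κ * t with hx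
    have hx0 : 0 ≤ x := by positivity
    have hκc : (κ:ℂ) ≠ 0 := by exact_mod_cast hκ.ne'
    have hexp : ∀ ω : ℝ, (((-δ * κ : ℝ) : ℂ) + Complex.I * (ω : ℂ)) * ((t : ℝ) : ℂ) =
        zl δ (ω / κ) * x := by
      intro ω
      rw [← line_div hκ, hx]; push_cast; field_simp
    simp_rw [hexp]
    rw [Measure.integral_comp_div (fun τ => cexp (zl δ τ * x) * Psi β ωp κ (zl δ τ)) κ]
    have hnexp : ∀ τ, ‖cexp (zl δ τ * x)‖ = Real.exp (-δ * x) := by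
      intro τ
      rw [Complex.norm_exp, re_mul_ofReal, zl_re]
    have hbm : ∀ f : ℝ → ℂ, Integrable f → Integrable fun τ => cexp (zl δ τ * x) * f τ := by
      intro f hf
      refine hf.bdd_mul (c := Real.exp (-δ * x)) ?_ (Filter.Eventually.of_forall fun τ => (hnexp τ).le)
      have := zl_continuous δ
      exact Continuous.aestronglyMeasurable (by fun_prop)
    have hI : ∫ τ, cexp (zl δ τ * x) * Psi β ωp κ (zl δ τ) = ∫ τ, cexp (zl δ τ * x) * D τ := by
      have e : ∀ τ, cexp (zl δ τ * x) * Psi β ωp κ (zl δ τ) = cexp (zl δ τ * x) * D τ -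
          (ωp:ℂ) ^ 2 * (cexp (zl δ τ * x) * (Pq β ωp κ (zl δ τ))⁻¹) := by
        intro τ; rw [hPsi_split]; ring
      simp_rw [e]
      rw [integral_sub (hbm D hDi) ((hbm _ hPinv).const_mul _), integral_const_mul,
        Pq_int_zero hβ hκ hδ hx0, mul_zero, sub_zero]
    have hfin : ‖∫ τ, cexp (zl δ τ * x) * D τ‖ ≤ Real.exp (-δ * x) * (κ ^ 2 * B * (3 * J)) := by
      rw [← hGint, ← integral_const_mul]
      refine norm_integral_le_of_norm_le (hGi.const_mul _) (Filter.Eventually.of_forall fun τ => ?_)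
      rw [norm_mul, hnexp]
      gcongr
      exact hDG τ
    rw [hI, norm_mul, norm_smul, norm_inv, norm_real, Real.norm_eq_abs, Real.norm_eq_abs, abs_abs,
      abs_of_pos hκ, abs_of_pos (by positivity)]
    have hpi : (2 * Real.pi)⁻¹ ≤ 1 := inv_le_one_of_one_le₀ (by linarith [Real.pi_gt_three])
    calc _ ≤ 1 * (κ * (Real.exp (-δ * x) * (κ ^ 2 * B * (3 * J)))) := by gcongr
      _ = B * (3 * J) * κ ^ 3 * Real.exp (-δ * x) := by ring
      _ ≤ (B * (3 * J) + 1) * κ ^ 3 * Real.exp (-δ * x) := by gcongr; linarith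
      _ = _ := by rw [hx, mul_assoc (-δ)]
end

section
/- Landau-damping decay rate of free transport with velocity moments (core estimate of Lemma 3.1, inequality (3.4)): Let j ∈ ℕ and σ > 3 + j. There exists C > 0, depending only on j and σ, such that for every M ≥ 0, every measurable g : ℝ³ × ℝ³ → ℂ satisfying |g(k,η)| ≤ M·(1 + |k| + |η|)^{−σ} for all (k,η), and every t ≥ 0, one has ∫_{ℝ³} |k|^j · |g(k, t·k)| dk ≤ C·M·(1 + t)^{−3−j}. -/
open MeasureTheory Complex

/-- **Landau-damping decay rate of free transport with velocity moments**
(core estimate of Lemma 3.1, inequality (3.4)). -/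
theorem free_transport_density_decay_with_moments
    (j : ℕ) (σ : ℝ) (hσ : 3 + (j : ℝ) < σ) :
    ∃ C > (0:ℝ), ∀ M : ℝ, 0 ≤ M →
      ∀ g : (EuclideanSpace ℝ (Fin 3)) × (EuclideanSpace ℝ (Fin 3)) → ℂ,
        Measurable g →
        (∀ p : (EuclideanSpace ℝ (Fin 3)) × (EuclideanSpace ℝ (Fin 3)),
          ‖g p‖ ≤ M * (1 + ‖p.1‖ + ‖p.2‖) ^ (-σ)) →
        ∀ t : ℝ, 0 ≤ t →
          (∫ k : EuclideanSpace ℝ (Fin 3), ‖k‖ ^ j * ‖g (k, t • k)‖)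
            ≤ C * M * (1 + t) ^ (-(3 + (j : ℝ))) := by
  set F : EuclideanSpace ℝ (Fin 3) → ℝ := fun x => (1 + ‖x‖) ^ (-(σ - j)) with hF
  have hFint : Integrable F := by
    apply integrable_one_add_norm
    simp only [finrank_euclideanSpace, Fintype.card_fin]
    push_cast
    linarith
  have hI : 0 ≤ ∫ x, F x := integral_nonneg fun x => by
    simp only [hF]
    positivity
  refine ⟨(∫ x, F x) + 1, by linarith, ?_⟩
  intro M hM g _ hb t ht
  have h1 : (0:ℝ) < 1 + t := by linarith
  have key : ∀ k : EuclideanSpace ℝ (Fin 3),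
      ‖k‖ ^ j * ‖g (k, t • k)‖ ≤ (M * ((1 + t) ^ j)⁻¹) * F ((1 + t) • k) := by
    intro k
    have hk := hb (k, t • k)
    have e1 : 1 + ‖k‖ + ‖t • k‖ = 1 + (1 + t) * ‖k‖ := by
      rw [norm_smul, Real.norm_of_nonneg ht]; ring
    simp only [e1] at hk
    have e2 : ‖(1 + t) • k‖ = (1 + t) * ‖k‖ := by
      rw [norm_smul, Real.norm_of_nonneg h1.le]
    have hpos : 0 < 1 + (1 + t) * ‖k‖ := by positivity
    have e3 : F ((1 + t) • k)
        = (1 + (1 + t) * ‖k‖) ^ (-σ) * (1 + (1 + t) * ‖k‖) ^ j := by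
      simp only [hF, e2]
      rw [← Real.rpow_natCast, ← Real.rpow_add hpos]
      congr 1; ring
    have e4 : ‖k‖ ^ j = ((1 + t) ^ j)⁻¹ * ((1 + t) * ‖k‖) ^ j := by
      rw [mul_pow]; field_simp
    have e5 : ((1 + t) * ‖k‖) ^ j ≤ (1 + (1 + t) * ‖k‖) ^ j := by
      gcongr; linarith
    calc ‖k‖ ^ j * ‖g (k, t • k)‖
        ≤ ‖k‖ ^ j * (M * (1 + (1 + t) * ‖k‖) ^ (-σ)) := by gcongr
      _ = (M * ((1 + t) ^ j)⁻¹) * ((1 + (1 + t) * ‖k‖) ^ (-σ) * ((1 + t) * ‖k‖) ^ j) := by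
          rw [e4]; ring
      _ ≤ _ := by rw [e3]; gcongr
  have hGint : Integrable fun k => (M * ((1 + t) ^ j)⁻¹) * F ((1 + t) • k) :=
    (hFint.comp_smul h1.ne').const_mul _
  have e6 : (1 + t) ^ (-(3 + (j : ℝ))) = ((1 + t) ^ j)⁻¹ * ((1 + t) ^ 3)⁻¹ := by
    rw [Real.rpow_neg h1.le, Real.rpow_add h1, Real.rpow_natCast, mul_inv, mul_comm]
    norm_cast
  calc (∫ k : EuclideanSpace ℝ (Fin 3), ‖k‖ ^ j * ‖g (k, t • k)‖)
      ≤ ∫ k, (M * ((1 + t) ^ j)⁻¹) * F ((1 + t) • k) :=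
        integral_mono_of_nonneg (Filter.Eventually.of_forall fun k => by positivity) hGint
          (Filter.Eventually.of_forall key)
    _ = (∫ x, F x) * M * (1 + t) ^ (-(3 + (j : ℝ))) := by
        rw [integral_const_mul, Measure.integral_comp_smul_of_nonneg volume F (1 + t) (hR := h1.le), e6]
        simp only [finrank_euclideanSpace, Fintype.card_fin, smul_eq_mul]
        ring
    _ ≤ _ := by
        gcongr
        linarith
end
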